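/- Observational substate lemma with a uniform extension: Let m ≥ n, let ρ and σ be quantum states on ℂ^n with supp(ρ) ⊆ supp(σ), let ψ be a purification of ρ in ℂ^n ⊗ ℂ^m, let 0 < p ≤ 1 and β > 1 be reals, and set k' := β·D(ρ‖σ) − 2·logb 2 (1 − β^{−1/2}). Then there exists an extension ω of σ in ℂ^n ⊗ ℂ^m such that for every POVM element F on ℂ^n ⊗ ℂ^m with Tr(F·|ψ⟩⟨ψ|) ≥ p, one has Tr(F·ω) ≥ p / 2^{k'/p}. -/

import Mathlib

open Matrix BigOperators
open scoped ComplexOrder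

noncomputable section

/-- A quantum state: positive semidefinite matrix with unit trace. -/
def IsState {d : Type*} [Fintype d] (ρ : Matrix d d ℂ) : Prop :=
  ρ.PosSemidef ∧ ρ.trace = 1

/-- `SuppLE ρ σ` : the support of `ρ` is contained in the support of `σ`,
expressed as inclusion of kernels the other way. -/
def SuppLE {d : Type*} [Fintype d] (ρ σ : Matrix d d ℂ) : Prop :=
  ∀ v : d → ℂ, σ *ᵥ v = 0 → ρ *ᵥ v = 0

/-- Matrix logarithm: apply `Real.log` to the eigenvalues (with `log 0 = 0`). -/
noncomputable def matLog {d : Type*} [Fintype d] [DecidableEq d]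
    (ρ : Matrix d d ℂ) : Matrix d d ℂ :=
  if h : ρ.IsHermitian then
    (h.eigenvectorUnitary : Matrix d d ℂ) *
      Matrix.diagonal (fun i => (Real.log (h.eigenvalues i) : ℂ)) *
      (star (h.eigenvectorUnitary : Matrix d d ℂ))
  else 0

/-- Quantum relative entropy `S(ρ‖σ) = Re Tr (ρ (log ρ - log σ))`. -/
noncomputable def relEnt {d : Type*} [Fintype d] [DecidableEq d]
    (ρ σ : Matrix d d ℂ) : ℝ :=
  (Matrix.trace (ρ * (matLog ρ - matLog σ))).re

/-- Trace norm of a Hermitian matrix: sum of absolute values of eigenvalues. -/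
noncomputable def traceNorm {d : Type*} [Fintype d] [DecidableEq d]
    (A : Matrix d d ℂ) : ℝ :=
  if h : A.IsHermitian then ∑ i, |h.eigenvalues i| else 0

/-- Rank-one operator `|ψ⟩⟨ψ|`. -/
def ketbra {d : Type*} (ψ : d → ℂ) : Matrix d d ℂ :=
  Matrix.of fun a b => ψ a * (starRingEnd ℂ) (ψ b)

/-- A POVM element: a positive semidefinite matrix `F` with `1 - F` positive semidefinite. -/
def IsPOVMElem {d : Type*} [Fintype d] [DecidableEq d] (F : Matrix d d ℂ) : Prop :=
  F.PosSemidef ∧ ((1 : Matrix d d ℂ) - F).PosSemidef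

/-- `trR F ρ = Re Tr (F ρ)`. -/
noncomputable def trR {d : Type*} [Fintype d] (F ρ : Matrix d d ℂ) : ℝ :=
  (Matrix.trace (F * ρ)).re

/-- Observational divergence `D(ρ‖σ)`. -/
noncomputable def obsDiv {d : Type*} [Fintype d] [DecidableEq d]
    (ρ σ : Matrix d d ℂ) : ℝ :=
  sSup {x : ℝ | ∃ F : Matrix d d ℂ, IsPOVMElem F ∧ trR F σ ≠ 0 ∧
    x = trR F ρ * Real.logb 2 (trR F ρ / trR F σ)}

/-- A probability distribution on `Fin n`. -/
def IsProbDist {n : ℕ} (P : Fin n → ℝ) : Prop :=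
  (∀ i, 0 ≤ P i) ∧ ∑ i, P i = 1

/-- Classical relative entropy (base 2); terms with `P i = 0` contribute `0`. -/
noncomputable def cRelEnt {n : ℕ} (P Q : Fin n → ℝ) : ℝ :=
  ∑ i, P i * Real.logb 2 (P i / Q i)

/-- Classical observational divergence. -/
noncomputable def cObsDiv {n : ℕ} (P Q : Fin n → ℝ) : ℝ :=
  sSup {x : ℝ | ∃ f : Fin n → ℝ, (∀ i, 0 ≤ f i ∧ f i ≤ 1) ∧
    (∑ i, f i * Q i) ≠ 0 ∧
    x = (∑ i, f i * P i) * Real.logb 2 ((∑ i, f i * P i) / (∑ i, f i * Q i))}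



lemma psd_factor {d : Type*} [Fintype d] {F : Matrix d d ℂ} (hF : F.PosSemidef) :
    ∃ B : Matrix d d ℂ, F = Bᴴ * B := by
  classical
  open scoped MatrixOrder in
  exact CStarAlgebra.nonneg_iff_eq_star_mul_self.mp hF.nonneg

lemma trR_nonneg' {d : Type*} [Fintype d] {F ρ : Matrix d d ℂ} (hF : F.PosSemidef)
    (hρ : ρ.PosSemidef) : 0 ≤ trR F ρ := by
  obtain ⟨B, rfl⟩ := psd_factor hF
  unfold trR
  rw [Matrix.mul_assoc, Matrix.trace_mul_comm]
  exact (Complex.nonneg_iff.1 (hρ.mul_mul_conjTranspose_same B).trace_nonneg).1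

lemma trR_add_left {d : Type*} [Fintype d] (F G ρ : Matrix d d ℂ) :
    trR (F + G) ρ = trR F ρ + trR G ρ := by
  simp [trR, Matrix.add_mul]

lemma trR_sub_left {d : Type*} [Fintype d] (F G ρ : Matrix d d ℂ) :
    trR (F - G) ρ = trR F ρ - trR G ρ := by
  simp [trR, Matrix.sub_mul]

lemma trR_add_right {d : Type*} [Fintype d] (F G ρ : Matrix d d ℂ) :
    trR ρ (F + G) = trR ρ F + trR ρ G := by
  simp [trR, Matrix.mul_add]

lemma trR_smul_left {d : Type*} [Fintype d] (a : ℝ) (F ρ : Matrix d d ℂ) :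
    trR (a • F) ρ = a * trR F ρ := by
  simp [trR]

lemma trR_smul_right {d : Type*} [Fintype d] (a : ℝ) (F ρ : Matrix d d ℂ) :
    trR F (a • ρ) = a * trR F ρ := by
  simp [trR]

lemma trR_one {d : Type*} [Fintype d] [DecidableEq d] {ρ : Matrix d d ℂ} (hρ : IsState ρ) :
    trR 1 ρ = 1 := by
  simp [trR, hρ.2]

lemma continuous_trR_right {d : Type*} [Fintype d] (F : Matrix d d ℂ) :
    Continuous (fun ρ => trR F ρ) := by
  unfold trR; fun_prop

lemma continuous_trR_left {d : Type*} [Fintype d] (ρ : Matrix d d ℂ) :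
    Continuous (fun F => trR F ρ) := by
  unfold trR; fun_prop

lemma psd_entry {d : Type*} [Fintype d] {F : Matrix d d ℂ} (hF : F.PosSemidef) (i j : d) :
    ‖F i j‖ ≤ ((F i i).re + (F j j).re) / 2 := by
  obtain ⟨B, rfl⟩ := psd_factor hF
  have h : ∀ i, ((Bᴴ * B) i i).re = ∑ k, ‖B k i‖ ^ 2 := by
    intro i
    simp only [Matrix.mul_apply, Matrix.conjTranspose_apply, Complex.re_sum]
    refine Finset.sum_congr rfl fun k _ => ?_
    rw [Complex.sq_norm, Complex.normSq_apply]
    simp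
  rw [h, h, ← Finset.sum_add_distrib, Finset.sum_div, Matrix.mul_apply]
  refine (norm_sum_le _ _).trans (Finset.sum_le_sum fun k _ => ?_)
  rw [norm_mul, Matrix.conjTranspose_apply, norm_star]
  nlinarith [sq_nonneg (‖B k i‖ - ‖B k j‖)]

lemma psd_diag_re_nonneg {d : Type*} [Fintype d] {F : Matrix d d ℂ} (hF : F.PosSemidef) (i : d) :
    0 ≤ (F i i).re := by
  have := psd_entry hF i i
  linarith [norm_nonneg (F i i)]

lemma isClosed_psd {d : Type*} [Fintype d] : IsClosed {A : Matrix d d ℂ | A.PosSemidef} := by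
  simp only [Matrix.posSemidef_iff_dotProduct_mulVec, Set.ofPred_and, Set.ofPred_forall]
  refine IsClosed.inter ?_ (isClosed_iInter fun x => ?_)
  · exact isClosed_eq (by fun_prop) continuous_id
  · simp only [Complex.nonneg_iff, Set.ofPred_and]
    refine IsClosed.inter (isClosed_le continuous_const ?_) (isClosed_eq continuous_const ?_)
    all_goals fun_prop

lemma isCompact_states {d : Type*} [Fintype d] : IsCompact {A : Matrix d d ℂ | IsState A} := by
  have h1 : IsCompact (Set.univ.pi fun _ : d => Set.univ.pi fun _ : d => Metric.closedBall (0:ℂ) 1) :=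
    isCompact_univ_pi fun _ => isCompact_univ_pi fun _ => isCompact_closedBall _ _
  refine IsCompact.of_isClosed_subset (s := (Set.univ.pi fun _ : d => Set.univ.pi fun _ : d => Metric.closedBall (0:ℂ) 1 : Set (Matrix d d ℂ))) h1 ?_ ?_
  · simp only [IsState, Set.ofPred_and]
    exact isClosed_psd.inter (isClosed_eq (by fun_prop) continuous_const)
  · intro A hA i _ j _
    have hd : ∀ i, (A i i).re ≤ 1 := by
      intro i
      have : ∑ k, (A k k).re = 1 := by
        have := congrArg Complex.re hA.2
        simpa [Matrix.trace, Matrix.diag] using this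
      rw [← this]
      exact Finset.single_le_sum (f := fun k => (A k k).re) (fun k _ => psd_diag_re_nonneg hA.1 k) (Finset.mem_univ i)
    have := psd_entry hA.1 i j
    simp only [mem_closedBall_zero_iff]
    linarith [hd i, hd j]

lemma convex_psd {d : Type*} [Fintype d] {A B : Matrix d d ℂ} (hA : A.PosSemidef)
    (hB : B.PosSemidef) {a b : ℝ} (ha : 0 ≤ a) (hb : 0 ≤ b) : (a • A + b • B).PosSemidef :=
  (hA.smul ha).add (hB.smul hb)

lemma convex_states {d : Type*} [Fintype d] : Convex ℝ {A : Matrix d d ℂ | IsState A} := by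
  intro A hA B hB a b ha hb hab
  refine ⟨convex_psd hA.1 hB.1 ha hb, ?_⟩
  rw [Matrix.trace_add, Matrix.trace_smul, Matrix.trace_smul, hA.2, hB.2]
  have : ((a + b : ℝ) : ℂ) = 1 := by rw [hab]; simp
  simpa using this

lemma minimax_aux {E F : Type*} [TopologicalSpace E] [AddCommGroup E] [Module ℝ E]
    [IsTopologicalAddGroup E] [ContinuousSMul ℝ E]
    [TopologicalSpace F] [AddCommGroup F] [Module ℝ F]
    [IsTopologicalAddGroup F] [ContinuousSMul ℝ F]
    {X : Set E} {Y : Set F} {f : E → F → ℝ} (ne_X : X.Nonempty) (cX : Convex ℝ X)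
    (kX : IsCompact X) (cY : Convex ℝ Y)
    (h1 : ∀ y, Continuous fun x => f x y) (h2 : ∀ x, Continuous fun y => f x y)
    (h3 : ∀ y, ConvexOn ℝ X fun x => f x y) (h4 : ∀ x, ConcaveOn ℝ Y fun y => f x y)
    (t : ℝ) (h : ∀ y ∈ Y, ∃ x ∈ X, f x y ≤ t) : ∃ x ∈ X, ∀ y ∈ Y, f x y ≤ t := by
  by_contra! hcon
  have hclosed : ∀ y : Y, IsClosed {x | f x y ≤ t} := fun y =>
    isClosed_le (h1 y) continuous_const
  obtain ⟨u, hu⟩ := kX.elim_finite_subfamily_closed (fun y : Y => {x | f x y ≤ t}) hclosed (by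
    ext x
    simp only [Set.mem_inter_iff, Set.mem_iInter, Set.mem_ofPred_eq, Set.mem_empty_iff_false,
      iff_false, not_and, not_forall, not_le]
    intro hx
    obtain ⟨y, hy, hlt⟩ := hcon x hx
    exact ⟨⟨y, hy⟩, hlt⟩)
  obtain ⟨y0, hy0, hlt⟩ := Sion.exists_lt_iInf_of_lt_iInf_of_finite (f := f) (t := t) ne_X kX
    (fun y _ => (h1 y).lowerSemicontinuous.lowerSemicontinuousOn X)
    (fun y _ => (h3 y).quasiconvexOn) cY
    (fun x _ => (h2 x).upperSemicontinuous.upperSemicontinuousOn Y)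
    (fun x _ => (h4 x).quasiconcaveOn) cX
    (s := Subtype.val '' (u : Set Y)) (u.finite_toSet.image _) (by
      rintro _ ⟨y, _, rfl⟩; exact y.2) (by
      intro x hx
      by_contra! hc
      have : x ∈ X ∩ ⋂ y ∈ u, {x | f x (y : Y) ≤ t} := by
        refine ⟨hx, ?_⟩
        simp only [Set.mem_iInter]
        intro y hy
        exact hc y ⟨y, hy, rfl⟩
      rw [hu] at this
      exact this)
  obtain ⟨x, hx, hle⟩ := h y0 hy0
  exact absurd (hlt x hx) (not_lt.2 hle)

/-- Spectral calculus in the basis given by `U`. -/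
def dg {d : Type*} [Fintype d] [DecidableEq d] (U : Matrix d d ℂ) (f : d → ℝ) : Matrix d d ℂ :=
  U * Matrix.diagonal (fun i => (f i : ℂ)) * Uᴴ

lemma exists_dg {d : Type*} [Fintype d] [DecidableEq d] {A : Matrix d d ℂ} (hA : A.IsHermitian) :
    ∃ (U : Matrix d d ℂ) (y : d → ℝ), Uᴴ * U = 1 ∧ U * Uᴴ = 1 ∧ A = dg U y := by
  refine ⟨hA.eigenvectorUnitary, hA.eigenvalues, ?_, ?_, ?_⟩
  · exact Unitary.coe_star_mul_self _
  · exact Unitary.coe_mul_star_self _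
  · have := hA.spectral_theorem
    rw [Unitary.conjStarAlgAut_apply] at this
    exact this

lemma trR_dg {d : Type*} [Fintype d] [DecidableEq d] (U ρ : Matrix d d ℂ) (f : d → ℝ) :
    trR (dg U f) ρ = ∑ i, f i * ((Uᴴ * ρ * U) i i).re := by
  unfold trR dg
  have : (U * Matrix.diagonal (fun i => (f i : ℂ)) * Uᴴ * ρ).trace =
      (Matrix.diagonal (fun i => (f i : ℂ)) * (Uᴴ * ρ * U)).trace := by
    rw [Matrix.mul_assoc, Matrix.mul_assoc, Matrix.trace_mul_comm]
    simp only [Matrix.mul_assoc]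
  rw [this]
  simp [Matrix.trace, Matrix.diagonal_mul]

lemma dg_mul {d : Type*} [Fintype d] [DecidableEq d] {U : Matrix d d ℂ} (hU : Uᴴ * U = 1)
    (f g : d → ℝ) : dg U f * dg U g = dg U (fun i => f i * g i) := by
  unfold dg
  calc _ = U * diagonal (fun i => (f i : ℂ)) * (Uᴴ * U) * diagonal (fun i => (g i : ℂ)) * Uᴴ := by
        simp only [Matrix.mul_assoc]
    _ = _ := by
        rw [hU, Matrix.mul_one, Matrix.mul_assoc U, Matrix.diagonal_mul_diagonal]
        simp

lemma dg_conj {d : Type*} [Fintype d] [DecidableEq d] (U : Matrix d d ℂ)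
    (f : d → ℝ) : (dg U f)ᴴ = dg U f := by
  unfold dg
  simp only [Matrix.conjTranspose_mul, Matrix.conjTranspose_conjTranspose,
    Matrix.diagonal_conjTranspose, Matrix.mul_assoc]
  congr 3
  ext i
  simp

lemma dg_psd {d : Type*} [Fintype d] [DecidableEq d] (U : Matrix d d ℂ)
    {f : d → ℝ} (hf : ∀ i, 0 ≤ f i) : (dg U f).PosSemidef := by
  unfold dg
  apply Matrix.PosSemidef.mul_mul_conjTranspose_same
  apply Matrix.PosSemidef.diagonal
  intro i
  simpa using hf i

lemma dg_add {d : Type*} [Fintype d] [DecidableEq d] (U : Matrix d d ℂ)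
    (f g : d → ℝ) : dg U f + dg U g = dg U (fun i => f i + g i) := by
  unfold dg
  rw [← Matrix.add_mul, ← Matrix.mul_add, Matrix.diagonal_add]
  simp

lemma dg_one {d : Type*} [Fintype d] [DecidableEq d] {U : Matrix d d ℂ} (hU : U * Uᴴ = 1) :
    dg U (fun _ => 1) = 1 := by
  unfold dg
  simp [hU]

lemma dg_nonneg_of_psd {d : Type*} [Fintype d] [DecidableEq d] {U : Matrix d d ℂ}
    (hU : Uᴴ * U = 1) {f : d → ℝ} (h : (dg U f).PosSemidef) (i : d) : 0 ≤ f i := by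
  have h1 := h.conjTranspose_mul_mul_same U
  have h2 : Uᴴ * dg U f * U = diagonal (fun i => (f i : ℂ)) := by
    unfold dg
    calc _ = (Uᴴ * U) * diagonal (fun i => (f i : ℂ)) * (Uᴴ * U) := by
          simp only [Matrix.mul_assoc]
      _ = _ := by simp [hU]
  rw [h2] at h1
  simpa using psd_diag_re_nonneg h1 i

lemma obs_bound {d : Type*} [Fintype d] [DecidableEq d] {ρ σ : Matrix d d ℂ}
    (hρ : ρ.PosSemidef) (hσ : σ.PosSemidef) (hsupp : SuppLE ρ σ) :
    ∃ C : ℝ, 0 < C ∧ ∀ F : Matrix d d ℂ, F.PosSemidef → trR F ρ ≤ C * trR F σ := by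
  obtain ⟨U, y, hU, hU', hy⟩ := exists_dg hσ.1
  have hy0 : ∀ i, 0 ≤ y i := dg_nonneg_of_psd hU (hy ▸ hσ)
  set R := Uᴴ * ρ * U with hR
  have hRpsd : R.PosSemidef := hρ.conjTranspose_mul_mul_same U
  have hcol : ∀ i j, y i = 0 → R j i = 0 := by
    intro i j hi
    have h1 : σ *ᵥ (U *ᵥ Pi.single i 1) = 0 := by
      rw [hy, dg, Matrix.mulVec_mulVec, Matrix.mul_assoc, hU, Matrix.mul_one,
        ← Matrix.mulVec_mulVec]
      have : diagonal (fun i => (y i : ℂ)) *ᵥ Pi.single i 1 = 0 := by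
        ext k
        rw [Matrix.mulVec_diagonal]
        by_cases hk : k = i
        · subst hk; simp [hi]
        · simp [hk]
      rw [this, Matrix.mulVec_zero]
    have h2 := hsupp _ h1
    have h3 : R *ᵥ Pi.single i 1 = 0 := by
      rw [hR, ← Matrix.mulVec_mulVec, ← Matrix.mulVec_mulVec, h2, Matrix.mulVec_zero]
    have := congrFun h3 j
    simpa using this
  have hrow : ∀ i j, y i = 0 → R i j = 0 := by
    intro i j hi
    have := hRpsd.1.apply i j
    rw [← this, hcol i j hi, star_zero]
  refine ⟨1 + ∑ i, ∑ j, ‖R j i‖ * (((y i)⁻¹ + (y j)⁻¹) / 2), ?_, ?_⟩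
  · have : 0 ≤ ∑ i, ∑ j, ‖R j i‖ * (((y i)⁻¹ + (y j)⁻¹) / 2) := by
      refine Finset.sum_nonneg fun i _ => Finset.sum_nonneg fun j _ => ?_
      have := inv_nonneg.2 (hy0 i)
      have := inv_nonneg.2 (hy0 j)
      positivity
    linarith
  intro F hF
  set G := Uᴴ * F * U with hG
  have hGpsd : G.PosSemidef := hF.conjTranspose_mul_mul_same U
  have hs : trR F σ = ∑ i, y i * (G i i).re := by
    rw [← trR_dg, hy, trR, trR, Matrix.trace_mul_comm]
  have hs0 : 0 ≤ trR F σ := trR_nonneg' hF hσ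
  have hsi : ∀ i, y i * (G i i).re ≤ trR F σ := by
    intro i
    rw [hs]
    exact Finset.single_le_sum (f := fun i => y i * (G i i).re)
      (fun k _ => mul_nonneg (hy0 k) (psd_diag_re_nonneg hGpsd k)) (Finset.mem_univ i)
  have hq : trR F ρ = (∑ i, ∑ j, G i j * R j i).re := by
    have : (F * ρ).trace = (G * R).trace := by
      have e : G * R = Uᴴ * (F * ρ) * U := by
        calc G * R = Uᴴ * F * (U * Uᴴ) * ρ * U := by rw [hG, hR]; simp only [Matrix.mul_assoc]
          _ = _ := by rw [hU']; simp only [Matrix.mul_assoc, Matrix.one_mul]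
      rw [e, Matrix.trace_mul_comm (Uᴴ * (F * ρ)) U, ← Matrix.mul_assoc, hU', Matrix.one_mul]
    rw [trR, this]
    simp [Matrix.trace, Matrix.mul_apply]
  have hmain : trR F ρ ≤ ∑ i, ∑ j, ‖R j i‖ * (((y i)⁻¹ + (y j)⁻¹) / 2) * trR F σ := by
    rw [hq]
    refine (Complex.re_le_norm _).trans ((norm_sum_le _ _).trans (Finset.sum_le_sum fun i _ =>
      (norm_sum_le _ _).trans (Finset.sum_le_sum fun j _ => ?_)))
    rw [norm_mul, mul_comm, mul_assoc]
    by_cases h0 : R j i = 0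
    · simp [h0]
    have hi : 0 < y i := lt_of_le_of_ne (hy0 i) (fun h => h0 (hcol i j h.symm))
    have hj : 0 < y j := lt_of_le_of_ne (hy0 j) (fun h => h0 (hrow j i h.symm))
    refine mul_le_mul_of_nonneg_left ?_ (norm_nonneg _)
    have e1 : (G i i).re ≤ (y i)⁻¹ * trR F σ := by
      rw [inv_mul_eq_div, le_div_iff₀ hi, mul_comm]; exact hsi i
    have e2 : (G j j).re ≤ (y j)⁻¹ * trR F σ := by
      rw [inv_mul_eq_div, le_div_iff₀ hj, mul_comm]; exact hsi j
    have := psd_entry hGpsd i j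
    linarith
  simp only [← Finset.sum_mul] at hmain
  linarith

lemma obs_bdd {d : Type*} [Fintype d] [DecidableEq d] {ρ σ : Matrix d d ℂ}
    (hρ : IsState ρ) (hσ : IsState σ) (hsupp : SuppLE ρ σ) :
    BddAbove {x : ℝ | ∃ F : Matrix d d ℂ, IsPOVMElem F ∧ trR F σ ≠ 0 ∧
    x = trR F ρ * Real.logb 2 (trR F ρ / trR F σ)} := by
  obtain ⟨C, hC, h⟩ := obs_bound hρ.1 hσ.1 hsupp
  refine ⟨|Real.logb 2 C|, ?_⟩
  rintro x ⟨F, hF, hne, rfl⟩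
  have hs : 0 < trR F σ := lt_of_le_of_ne (trR_nonneg' hF.1 hσ.1) (Ne.symm hne)
  have hq0 : 0 ≤ trR F ρ := trR_nonneg' hF.1 hρ.1
  have hq1 : trR F ρ ≤ 1 := by
    have := trR_nonneg' hF.2 hρ.1
    rw [trR_sub_left, trR_one hρ] at this
    linarith
  rcases hq0.eq_or_lt with h0 | h0
  · rw [← h0]; simp
  have : Real.logb 2 (trR F ρ / trR F σ) ≤ Real.logb 2 C := by
    apply Real.logb_le_logb_of_le (by norm_num) (by positivity)
    rw [div_le_iff₀ hs]
    exact h F hF.1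
  calc _ ≤ trR F ρ * |Real.logb 2 C| :=
        mul_le_mul_of_nonneg_left (this.trans (le_abs_self _)) hq0
    _ ≤ 1 * |Real.logb 2 C| := mul_le_mul_of_nonneg_right hq1 (abs_nonneg _)
    _ = _ := one_mul _

lemma obs_nonneg {d : Type*} [Fintype d] [DecidableEq d] {ρ σ : Matrix d d ℂ}
    (hρ : IsState ρ) (hσ : IsState σ) (hsupp : SuppLE ρ σ) : 0 ≤ obsDiv ρ σ := by
  refine le_csSup (obs_bdd hρ hσ hsupp) ⟨1, ⟨Matrix.PosSemidef.one, ?_⟩, ?_, ?_⟩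
  · simpa using Matrix.PosSemidef.zero
  · simp [trR_one hσ]
  · simp [trR_one hσ, trR_one hρ]

lemma bad_bound {d : Type*} [Fintype d] [DecidableEq d] {P Q : d → ℝ} {D p β : ℝ}
    (hQ : ∀ i, 0 ≤ Q i) (hp : 0 < p) (hβ : 1 < β) (hD0 : 0 ≤ D) {C : ℝ}
    (hC : ∀ i, P i ≤ C * Q i)
    (hD : ∀ S : Finset d, ∑ i ∈ S, Q i ≠ 0 →
      (∑ i ∈ S, P i) * Real.logb 2 ((∑ i ∈ S, P i) / ∑ i ∈ S, Q i) ≤ D)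
    (S : Finset d) (hS : ∀ i ∈ S, (2 : ℝ) ^ (β * D / p) * Q i < P i) :
    ∑ i ∈ S, P i ≤ p / β := by
  rcases S.eq_empty_or_nonempty with rfl | hne
  · simp; positivity
  have hQpos : ∀ i ∈ S, 0 < Q i := by
    intro i hi
    refine lt_of_le_of_ne (hQ i) fun h => ?_
    have h1 := hS i hi
    have h2 := hC i
    rw [← h] at h1 h2
    linarith
  have hQS : 0 < ∑ i ∈ S, Q i := Finset.sum_pos hQpos hne
  have hlt : (2 : ℝ) ^ (β * D / p) * ∑ i ∈ S, Q i < ∑ i ∈ S, P i := by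
    rw [Finset.mul_sum]
    exact Finset.sum_lt_sum_of_nonempty hne hS
  set a := ∑ i ∈ S, P i
  set b := ∑ i ∈ S, Q i
  have ha : 0 < a := lt_of_le_of_lt (by positivity) hlt
  have hlog : β * D / p < Real.logb 2 (a / b) := by
    rw [Real.lt_logb_iff_rpow_lt (by norm_num) (by positivity), lt_div_iff₀ hQS]
    exact hlt
  have h1 := hD S hQS.ne'
  have h2 : a * (β * D / p) < D := lt_of_lt_of_le (mul_lt_mul_of_pos_left hlog ha) h1
  have hβ0 : 0 < β := by linarith
  have hDpos : 0 < D := lt_of_le_of_lt (by positivity) h2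
  rw [le_div_iff₀ hβ0]
  have h3 : a * β * D < D * p := by
    have := mul_lt_mul_of_pos_right h2 hp
    have e : a * (β * D / p) * p = a * β * D := by field_simp
    linarith
  nlinarith

lemma ketbra_mulVec {d : Type*} [Fintype d] (A : Matrix d d ℂ) (v : d → ℂ) :
    ketbra (A *ᵥ v) = A * ketbra v * Aᴴ := by
  have h : ∀ w : d → ℂ, ketbra w = Matrix.vecMulVec w (star w) := by
    intro w; ext i j; simp [ketbra, Matrix.vecMulVec_apply]
  rw [h, h, Matrix.mul_vecMulVec, Matrix.vecMulVec_mul, Matrix.star_mulVec]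

lemma ketbra_psd {d : Type*} [Fintype d] (v : d → ℂ) : (ketbra v).PosSemidef := by
  have : ketbra v = Matrix.vecMulVec v (star v) := by
    ext i j; simp [ketbra, Matrix.vecMulVec_apply]
  rw [this]
  exact Matrix.posSemidef_vecMulVec_self_star v

lemma trR_ketbra_mulVec {d : Type*} [Fintype d] (F A : Matrix d d ℂ) (v : d → ℂ) :
    trR F (ketbra (A *ᵥ v)) = trR (Aᴴ * F * A) (ketbra v) := by
  rw [ketbra_mulVec, trR, trR, ← Matrix.mul_assoc, Matrix.trace_mul_comm]
  simp only [Matrix.mul_assoc]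

lemma trR_one_ketbra {d : Type*} [Fintype d] [DecidableEq d] (v : d → ℂ) :
    trR 1 (ketbra v) = ‖WithLp.toLp 2 v‖ ^ 2 := by
  rw [EuclideanSpace.norm_sq_eq]
  simp [trR, ketbra, Matrix.trace, Complex.sq_norm, Complex.normSq_apply]

lemma trR_ketbra_eq {d : Type*} [Fintype d] (F : Matrix d d ℂ) (v : d → ℂ) :
    trR F (ketbra v) = (star v ⬝ᵥ F *ᵥ v).re := by
  simp only [trR, ketbra, Matrix.trace, Matrix.mul_apply, Matrix.mulVec, dotProduct,
    Matrix.diag, Matrix.of_apply, Finset.mul_sum, Pi.star_apply]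
  congr 1
  refine Finset.sum_congr rfl fun i _ => Finset.sum_congr rfl fun j _ => ?_
  simp only [Complex.star_def]
  ring

lemma sqrt_triangle {d : Type*} [Fintype d] {F : Matrix d d ℂ} (hF : F.PosSemidef)
    (v w : d → ℂ) : √(trR F (ketbra (v + w))) ≤ √(trR F (ketbra v)) + √(trR F (ketbra w)) := by
  classical
  obtain ⟨B, rfl⟩ := psd_factor hF
  have h : ∀ u, √(trR (Bᴴ * B) (ketbra u)) = ‖WithLp.toLp 2 (B *ᵥ u)‖ := by
    intro u
    have := trR_ketbra_mulVec 1 B u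
    rw [Matrix.mul_one] at this
    rw [← this, trR_one_ketbra, Real.sqrt_sq (norm_nonneg _)]
  rw [h, h, h, Matrix.mulVec_add, WithLp.toLp_add]
  exact norm_add_le _ _

open scoped Kronecker

/-- Partial trace over the second factor. -/
def ptr {n m : Type*} [Fintype m] (ω : Matrix (n × m) (n × m) ℂ) : Matrix n n ℂ :=
  Matrix.of fun i j => ∑ l, ω (i, l) (j, l)

lemma trace_kron {n m : Type*} [Fintype n] [Fintype m] [DecidableEq m] (Y : Matrix n n ℂ)
    (ω : Matrix (n × m) (n × m) ℂ) :
    trR (Y ⊗ₖ (1 : Matrix m m ℂ)) ω = trR Y (ptr ω) := by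
  unfold trR
  congr 1
  simp only [Matrix.trace, Matrix.diag, Matrix.mul_apply, Fintype.sum_prod_type, ptr,
    Matrix.kroneckerMap_apply, Matrix.of_apply, Finset.mul_sum, Matrix.one_apply]
  refine Finset.sum_congr rfl fun i _ => ?_
  rw [Finset.sum_comm]
  refine Finset.sum_congr rfl fun j _ => ?_
  refine Finset.sum_congr rfl fun l _ => ?_
  simp

lemma key_ineq {n m : Type*} [Fintype n] [Fintype m] [DecidableEq n] [DecidableEq m] [Nonempty m]
    {ρ σ : Matrix n n ℂ} (hρ : IsState ρ) (hσ : IsState σ) (hsupp : SuppLE ρ σ)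
    (ψ : n × m → ℂ) (hψ : ptr (ketbra ψ) = ρ) {p β : ℝ} (hp0 : 0 < p) (hβ : 1 < β)
    {F : Matrix (n × m) (n × m) ℂ} (hF : IsPOVMElem F) (hFp : p ≤ trR F (ketbra ψ))
    {Y : Matrix n n ℂ} (hY : Y.IsHermitian)
    (hYF : (Y ⊗ₖ (1 : Matrix m m ℂ) - F).PosSemidef) :
    (√p - √(p / β)) ^ 2 ≤ (2 : ℝ) ^ (β * obsDiv ρ σ / p) * trR Y σ := by
  classical
  have hYpsd : Y.PosSemidef := by
    have h1 : (Y ⊗ₖ (1 : Matrix m m ℂ)).PosSemidef := by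
      simpa using hYF.add hF.1
    have l0 : m := Classical.arbitrary m
    have h2 := h1.submatrix (fun i : n => (i, l0))
    convert h2 using 1
    ext i j
    simp
  obtain ⟨U, y, hU, hU', rfl⟩ := exists_dg hY
  have hy0 : ∀ i, 0 ≤ y i := dg_nonneg_of_psd hU hYpsd
  set P : n → ℝ := fun i => ((Uᴴ * ρ * U) i i).re with hP
  set Q : n → ℝ := fun i => ((Uᴴ * σ * U) i i).re with hQ
  set D := obsDiv ρ σ with hD
  have hQ0 : ∀ i, 0 ≤ Q i := psd_diag_re_nonneg (hσ.1.conjTranspose_mul_mul_same U)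
  have hP0 : ∀ i, 0 ≤ P i := psd_diag_re_nonneg (hρ.1.conjTranspose_mul_mul_same U)
  obtain ⟨C, -, hC⟩ := obs_bound hρ.1 hσ.1 hsupp
  have ind : ∀ S : Finset n, ∀ A : Matrix n n ℂ, trR (dg U (fun i => if i ∈ S then 1 else 0)) A
      = ∑ i ∈ S, ((Uᴴ * A * U) i i).re := by
    intro S A
    rw [trR_dg]
    simp
  have indpsd : ∀ S : Finset n, (dg U (fun i => if i ∈ S then 1 else 0)).PosSemidef := by
    intro S
    apply dg_psd
    intro i; split_ifs <;> norm_num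
  have indcompl : ∀ S : Finset n, dg U (fun i => if i ∈ S then 1 else 0) +
      dg U (fun i => if i ∈ Sᶜ then 1 else 0) = 1 := by
    intro S
    rw [dg_add, ← dg_one hU']
    congr 1
    ext i
    by_cases h : i ∈ S <;> simp [h]
  have hbad := bad_bound (P := P) (Q := Q) (D := D) (p := p) (β := β) (C := C) hQ0 hp0 hβ
    (obs_nonneg hρ hσ hsupp)
    (by
      intro i
      have := hC _ (indpsd {i})
      rw [ind, ind] at this
      simpa using this)
    (by
      intro S hS
      refine le_csSup (obs_bdd hρ hσ hsupp) ⟨dg U (fun i => if i ∈ S then 1 else 0),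
        ⟨indpsd S, ?_⟩, ?_, ?_⟩
      · rw [← indcompl S, add_sub_cancel_left]
        exact indpsd _
      · rw [ind]; exact hS
      · rw [ind, ind])
    (Finset.univ.filter fun i => (2 : ℝ) ^ (β * D / p) * Q i < P i)
    (by intro i hi; simpa using hi)
  set S := Finset.univ.filter fun i => (2 : ℝ) ^ (β * D / p) * Q i < P i with hS
  set Pb := dg U (fun i => if i ∈ S then 1 else 0) with hPb
  set Pg := dg U (fun i => if i ∈ Sᶜ then 1 else 0) with hPg
  set vb := (Pb ⊗ₖ (1 : Matrix m m ℂ)) *ᵥ ψ with hvb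
  set vg := (Pg ⊗ₖ (1 : Matrix m m ℂ)) *ᵥ ψ with hvg
  have hsum : ψ = vg + vb := by
    rw [hvb, hvg, ← Matrix.add_mulVec, ← Matrix.add_kronecker, add_comm Pg, hPb, hPg, indcompl S]
    simp
  have hconj : ∀ (f : n → ℝ) (A : Matrix n n ℂ),
      trR (A ⊗ₖ (1 : Matrix m m ℂ)) (ketbra ((dg U f ⊗ₖ (1 : Matrix m m ℂ)) *ᵥ ψ)) =
      trR (dg U f * A * dg U f) ρ := by
    intro f A
    rw [trR_ketbra_mulVec, Matrix.conjTranspose_kronecker, dg_conj, Matrix.conjTranspose_one,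
      ← Matrix.mul_kronecker_mul, ← Matrix.mul_kronecker_mul, Matrix.mul_one, Matrix.mul_one,
      trace_kron, hψ]
  have hb : trR F (ketbra vb) ≤ p / β := by
    have h1 := trR_nonneg' hF.2 (ketbra_psd vb)
    rw [trR_sub_left] at h1
    have h2 : trR 1 (ketbra vb) = ∑ i ∈ S, P i := by
      rw [← Matrix.one_kronecker_one (m := n) (n := m), hvb, hPb, hconj, Matrix.mul_one,
        dg_mul hU, ← ind]
      congr 2
      ext i
      split_ifs <;> simp
    linarith
  have hg : trR F (ketbra vg) ≤ (2 : ℝ) ^ (β * D / p) * trR (dg U y) σ := by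
    have h1 := trR_nonneg' hYF (ketbra_psd vg)
    rw [trR_sub_left] at h1
    have h2 : trR (dg U y ⊗ₖ (1 : Matrix m m ℂ)) (ketbra vg) ≤
        (2 : ℝ) ^ (β * D / p) * trR (dg U y) σ := by
      rw [hvg, hPg, hconj, dg_mul hU, dg_mul hU, trR_dg, trR_dg, Finset.mul_sum]
      refine Finset.sum_le_sum fun i _ => ?_
      change _ * P i ≤ _ * (y i * Q i)
      by_cases hi : i ∈ S
      · simp only [Finset.mem_compl, hi, not_true_eq_false, if_false, zero_mul, mul_zero]
        have := hy0 i
        have := hQ0 i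
        positivity
      · have h3 : P i ≤ (2 : ℝ) ^ (β * D / p) * Q i := by
          simpa [hS] using hi
        simp only [Finset.mem_compl, hi, not_false_eq_true, if_true, one_mul, mul_one]
        calc y i * P i ≤ y i * ((2 : ℝ) ^ (β * D / p) * Q i) :=
              mul_le_mul_of_nonneg_left h3 (hy0 i)
          _ = _ := by ring
    linarith
  have htri := sqrt_triangle hF.1 vg vb
  rw [← hsum] at htri
  have e1 : √p ≤ √(trR F (ketbra ψ)) := Real.sqrt_le_sqrt hFp
  have e2 : √(trR F (ketbra vb)) ≤ √(p / β) := Real.sqrt_le_sqrt hb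
  have e3 : √(p / β) ≤ √p := Real.sqrt_le_sqrt (div_le_self hp0.le hβ.le)
  have e4 : √p - √(p / β) ≤ √(trR F (ketbra vg)) := by linarith
  calc _ ≤ √(trR F (ketbra vg)) ^ 2 := pow_le_pow_left₀ (by linarith) e4 2
    _ = trR F (ketbra vg) := Real.sq_sqrt (trR_nonneg' hF.1 (ketbra_psd vg))
    _ ≤ _ := hg

lemma numeric {p β D k' : ℝ} (hp0 : 0 < p) (hp1 : p ≤ 1) (hβ : 1 < β)
    (hk' : k' = β * D - 2 * Real.logb 2 (1 - β ^ (-(1 : ℝ) / 2))) {x : ℝ}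
    (h : (√p - √(p / β)) ^ 2 ≤ (2 : ℝ) ^ (β * D / p) * x) : p / (2 : ℝ) ^ (k' / p) ≤ x := by
  have hβ0 : 0 < β := by linarith
  set s := β ^ (-(1 : ℝ) / 2) with hs
  have hs1 : s < 1 := Real.rpow_lt_one_of_one_lt_of_neg hβ (by norm_num)
  have hs0 : 0 < s := Real.rpow_pos_of_pos hβ0 _
  have hss : √(p / β) = √p * s := by
    rw [Real.sqrt_div hp0.le, hs, neg_div, Real.rpow_neg hβ0.le, ← Real.sqrt_eq_rpow, div_eq_mul_inv]
  have h1 : (√p - √(p / β)) ^ 2 = p * (1 - s) ^ 2 := by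
    rw [hss]
    have := Real.sq_sqrt hp0.le
    linear_combination (1 - s) ^ 2 * this
  rw [h1] at h
  have h2 : (2 : ℝ) ^ (k' / p) = (2 : ℝ) ^ (β * D / p) * (1 - s) ^ (-(2 / p)) := by
    have e : k' / p = β * D / p + Real.logb 2 (1 - s) * (-(2 / p)) := by
      rw [hk']; ring
    rw [e, Real.rpow_add (by norm_num), Real.rpow_mul (by norm_num),
      Real.rpow_logb (by norm_num) (by norm_num) (by linarith)]
  have h3 : (1 - s) ^ (2 / p) ≤ (1 - s) ^ (2 : ℕ) := by
    rw [← Real.rpow_natCast]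
    apply Real.rpow_le_rpow_of_exponent_ge (by linarith) (by linarith)
    rw [le_div_iff₀ hp0]
    push_cast
    linarith
  have hK : 0 < (2 : ℝ) ^ (β * D / p) := by positivity
  have hA : 0 < (1 - s) ^ (2 / p) := Real.rpow_pos_of_pos (by linarith) _
  rw [h2, Real.rpow_neg (by linarith), div_le_iff₀ (by positivity)]
  have h4 : p * (1 - s) ^ (2 / p) ≤ (2 : ℝ) ^ (β * D / p) * x :=
    (mul_le_mul_of_nonneg_left h3 hp0.le).trans h
  calc p = p * (1 - s) ^ (2 / p) * ((1 - s) ^ (2 / p))⁻¹ := by field_simp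
    _ ≤ (2 : ℝ) ^ (β * D / p) * x * ((1 - s) ^ (2 / p))⁻¹ :=
        mul_le_mul_of_nonneg_right h4 (by positivity)
    _ = _ := by ring

lemma ketbra_state {d : Type*} [Fintype d] {v : d → ℂ} (hv : ‖WithLp.toLp 2 v‖ = 1) :
    IsState (ketbra v) := by
  classical
  refine ⟨ketbra_psd v, ?_⟩
  have h1 := trR_one_ketbra v
  rw [hv, trR, Matrix.one_mul, one_pow] at h1
  have h2 := (Complex.nonneg_iff.1 (ketbra_psd v).trace_nonneg).2
  exact Complex.ext (by simpa using h1) (by simpa using h2.symm)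

lemma exists_max_state {d : Type*} [Fintype d] [DecidableEq d] {H : Matrix d d ℂ}
    (hH : H.IsHermitian) (hne : {A : Matrix d d ℂ | IsState A}.Nonempty) :
    ∃ ω : Matrix d d ℂ, IsState ω ∧ (trR H ω • (1 : Matrix d d ℂ) - H).PosSemidef := by
  obtain ⟨ω, hω, hmax⟩ := isCompact_states.exists_isMaxOn hne (continuous_trR_right H).continuousOn
  refine ⟨ω, hω, ?_⟩
  have hherm : (trR H ω • (1 : Matrix d d ℂ) - H).IsHermitian := by
    refine Matrix.IsHermitian.sub ?_ hH
    simp [Matrix.IsHermitian, Matrix.conjTranspose_smul]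
  refine Matrix.PosSemidef.of_dotProduct_mulVec_nonneg hherm fun x => ?_
  have him : (star x ⬝ᵥ (trR H ω • (1 : Matrix d d ℂ) - H) *ᵥ x).im = 0 :=
    hherm.im_star_dotProduct_mulVec_self x
  rw [Complex.nonneg_iff]
  refine ⟨?_, him.symm⟩
  rw [← trR_ketbra_eq, trR_sub_left, trR_smul_left, trR_one_ketbra]
  by_cases hx : ‖WithLp.toLp 2 x‖ = 0
  · have : x = 0 := by
      have := norm_eq_zero.1 hx
      simpa using this
    subst this
    have : ketbra (0 : d → ℂ) = 0 := by ext i j; simp [ketbra]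
    simp [this, trR]
  set r := ‖WithLp.toLp 2 x‖ with hr
  have hst : IsState (ketbra (((r : ℂ)⁻¹) • x)) := by
    apply ketbra_state
    rw [WithLp.toLp_smul, norm_smul, norm_inv, ← hr]
    simp only [Complex.norm_real, Real.norm_eq_abs]
    rw [abs_of_nonneg (norm_nonneg _)]
    exact inv_mul_cancel₀ hx
  have h1 : trR H (ketbra (((r : ℂ)⁻¹) • x)) ≤ trR H ω := hmax hst
  have h2 : ketbra (((r : ℂ)⁻¹) • x) = ((r ^ 2)⁻¹ : ℝ) • ketbra x := by
    ext i j
    simp [ketbra]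
    ring
  rw [h2, trR_smul_right, inv_mul_eq_div, div_le_iff₀ (by positivity)] at h1
  linarith

lemma ptr_add {n m : Type*} [Fintype m] (A B : Matrix (n × m) (n × m) ℂ) :
    ptr (A + B) = ptr A + ptr B := by
  ext i j; simp [ptr, Finset.sum_add_distrib]

lemma ptr_smul {n m : Type*} [Fintype m] (a : ℝ) (A : Matrix (n × m) (n × m) ℂ) :
    ptr (a • A) = a • ptr A := by
  ext i j; simp [ptr, Finset.mul_sum]

lemma continuous_ptr {n m : Type*} [Fintype m] :
    Continuous (ptr : Matrix (n × m) (n × m) ℂ → Matrix n n ℂ) := by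
  unfold ptr; fun_prop

lemma ptr_herm {n m : Type*} [Fintype m] {A : Matrix (n × m) (n × m) ℂ} (hA : A.IsHermitian) :
    (ptr A).IsHermitian := by
  ext i j
  simp only [ptr, Matrix.conjTranspose_apply, Matrix.of_apply, star_sum]
  exact Finset.sum_congr rfl fun l _ => hA.apply _ _

lemma herm_smul {d : Type*} {A : Matrix d d ℂ} (hA : A.IsHermitian) (t : ℝ) :
    (t • A).IsHermitian := by
  unfold Matrix.IsHermitian
  rw [Matrix.conjTranspose_smul, hA]
  simp

lemma eq_zero_of_trR_self {d : Type*} [Fintype d] {A : Matrix d d ℂ} (hA : A.IsHermitian)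
    (h : trR A A ≤ 0) : A = 0 := by
  have h1 := (Matrix.posSemidef_conjTranspose_mul_self A).trace_nonneg
  apply Matrix.trace_conjTranspose_mul_self_eq_zero_iff.1
  rw [hA] at h1 ⊢
  have h2 := Complex.nonneg_iff.1 h1
  exact Complex.ext (le_antisymm h h2.1) h2.2.symm

/-- Observational substate lemma with a uniform extension. -/
theorem observational_substate_uniform_extension {n m : ℕ} (hnm : n ≤ m)
    (ρ σ : Matrix (Fin n) (Fin n) ℂ) (hρ : IsState ρ) (hσ : IsState σ)
    (hsupp : SuppLE ρ σ)
    (ψ : Fin n × Fin m → ℂ) (hψunit : ∑ p, Complex.normSq (ψ p) = 1)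
    (hψpur : ∀ i j : Fin n, ∑ l : Fin m, ψ (i, l) * (starRingEnd ℂ) (ψ (j, l)) = ρ i j)
    (p : ℝ) (hp0 : 0 < p) (hp1 : p ≤ 1)
    (β : ℝ) (hβ : 1 < β)
    (k' : ℝ)
    (hk' : k' = β * obsDiv ρ σ - 2 * Real.logb 2 (1 - β ^ (-(1 : ℝ) / 2))) :
    ∃ ω : Matrix (Fin n × Fin m) (Fin n × Fin m) ℂ, IsState ω ∧
      (∀ i j : Fin n, ∑ l : Fin m, ω (i, l) (j, l) = σ i j) ∧
      ∀ F : Matrix (Fin n × Fin m) (Fin n × Fin m) ℂ, IsPOVMElem F →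
        trR F (ketbra ψ) ≥ p → trR F ω ≥ p / (2 : ℝ) ^ (k' / p) := by
  have hn : n ≠ 0 := by
    rintro rfl
    have := hρ.2
    simp [Matrix.trace] at this
  have : Nonempty (Fin m) := ⟨⟨0, by omega⟩⟩
  have hψnorm : ‖WithLp.toLp 2 ψ‖ = 1 := by
    have : ‖WithLp.toLp 2 ψ‖ ^ 2 = 1 := by
      rw [EuclideanSpace.norm_sq_eq]
      simpa [Complex.sq_norm] using hψunit
    exact (pow_eq_one_iff_of_nonneg (norm_nonneg _) (by norm_num)).1 this
  have hψst := ketbra_state hψnorm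
  have hne : {A : Matrix (Fin n × Fin m) (Fin n × Fin m) ℂ | IsState A}.Nonempty := ⟨_, hψst⟩
  have hψptr : ptr (ketbra ψ) = ρ := by
    ext i j; simpa [ptr, ketbra] using hψpur i j
  set c := p / (2 : ℝ) ^ (k' / p) with hc
  set YF : Set (Matrix (Fin n) (Fin n) ℂ × Matrix (Fin n × Fin m) (Fin n × Fin m) ℂ) :=
    {q | q.1.IsHermitian ∧ IsPOVMElem q.2 ∧ p ≤ trR q.2 (ketbra ψ)} with hYF
  have cY : Convex ℝ YF := by
    rintro ⟨Y, F⟩ ⟨h1, h2, h3⟩ ⟨Y', F'⟩ ⟨h1', h2', h3'⟩ a b ha hb hab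
    refine ⟨(herm_smul h1 a).add (herm_smul h1' b), ⟨convex_psd h2.1 h2'.1 ha hb, ?_⟩, ?_⟩
    · have := convex_psd h2.2 h2'.2 ha hb
      convert this using 1
      have e : (1 : Matrix (Fin n × Fin m) (Fin n × Fin m) ℂ) = (a + b) • 1 := by
        rw [hab, one_smul]
      simp only [Prod.snd_add, Prod.smul_snd]
      nth_rewrite 1 [e]
      module
    · simp only [Prod.snd_add, Prod.smul_snd] at *
      rw [trR_add_left, trR_smul_left, trR_smul_left]
      nlinarith
  obtain ⟨ω, hω, hall⟩ := minimax_aux (Y := YF)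
    (f := fun ω q => trR q.1 (ptr ω) - trR q.1 σ - trR q.2 ω) hne convex_states isCompact_states cY
    (fun q => (((continuous_trR_right q.1).comp continuous_ptr).sub continuous_const).sub
      (continuous_trR_right q.2))
    (fun ω => (((continuous_trR_left _).comp continuous_fst).sub
      ((continuous_trR_left _).comp continuous_fst)).sub
      ((continuous_trR_left _).comp continuous_snd))
    (by
      rintro ⟨Y, F⟩
      refine ⟨convex_states, ?_⟩
      intro A _ B _ a b ha hb hab
      apply le_of_eq
      simp only [ptr_add, ptr_smul, trR_add_right, trR_smul_right, smul_eq_mul]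
      linear_combination (trR Y σ) * hab)
    (by
      intro ω
      refine ⟨cY, ?_⟩
      intro A _ B _ a b ha hb hab
      apply le_of_eq
      simp only [Prod.fst_add, Prod.snd_add, Prod.smul_fst, Prod.smul_snd, trR_add_left,
        trR_smul_left, smul_eq_mul]
      ring)
    (-c) (by
      rintro ⟨Y, F⟩ ⟨h1, h2, h3⟩
      simp only at h1 h2 h3
      have hk : (Y ⊗ₖ (1 : Matrix (Fin m) (Fin m) ℂ)).IsHermitian := by
        unfold Matrix.IsHermitian
        rw [Matrix.conjTranspose_kronecker, h1, Matrix.conjTranspose_one]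
      obtain ⟨ω, hω, hmax⟩ := exists_max_state (h2.1.1.sub hk) hne
      refine ⟨ω, hω, ?_⟩
      set t := trR (F - Y ⊗ₖ (1 : Matrix (Fin m) (Fin m) ℂ)) ω with ht
      have hY' : (Y + t • (1 : Matrix (Fin n) (Fin n) ℂ)).IsHermitian :=
        h1.add (herm_smul Matrix.isHermitian_one t)
      have hk2 := key_ineq (m := Fin m) hρ hσ hsupp ψ hψptr hp0 hβ h2 h3 hY' (by
        convert hmax using 1
        rw [Matrix.add_kronecker, Matrix.smul_kronecker, Matrix.one_kronecker_one]
        abel)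
      have hk3 := numeric hp0 hp1 hβ hk' hk2
      rw [trR_add_left, trR_smul_left, trR_one hσ, ht, trR_sub_left, trace_kron] at hk3
      simp only
      linarith)
  have hone : IsPOVMElem (1 : Matrix (Fin n × Fin m) (Fin n × Fin m) ℂ) :=
    ⟨Matrix.PosSemidef.one, by simpa using Matrix.PosSemidef.zero⟩
  have hptr : ptr ω = σ := by
    rw [← sub_eq_zero]
    have hherm : (ptr ω - σ).IsHermitian := (ptr_herm hω.1.1).sub hσ.1.1
    apply eq_zero_of_trR_self hherm
    by_contra! hpos
    set N := trR (ptr ω - σ) (ptr ω - σ) with hN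
    have hN' : N = trR (ptr ω - σ) (ptr ω) - trR (ptr ω - σ) σ := by
      rw [hN]; simp [trR, Matrix.mul_sub]
    have h1 := hall (((2 - c) / N) • (ptr ω - σ), 1) ⟨herm_smul hherm _, hone, by
      simpa [trR_one hψst] using hp1⟩
    simp only [trR_smul_left, trR_one hω] at h1
    rw [← mul_sub, ← hN', div_mul_cancel₀ _ hpos.ne'] at h1
    linarith
  refine ⟨ω, hω, fun i j => ?_, fun F hF hFp => ?_⟩
  · rw [← hptr]; rfl
  · have h1 := hall (0, F) ⟨Matrix.isHermitian_zero, hF, hFp⟩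
    simp only [trR, Matrix.zero_mul, Matrix.trace_zero, Complex.zero_re] at h1
    simp only [trR]
    linarith

end
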